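/- Let n ≥ 2, T > 0, 0 ≤ Θ < μ ≤ 1, and let γ̃_{i,j} (i ≠ j) be functions of class N. Let x_i : [−T,∞) → ℝ^{k_i} (i = 1,…,n) be bounded functions satisfying, for all t ≥ 0 and all i, |x_i(t)| ≤ max{ μ·‖x_i‖_{[t−T,t]}, (μ(1−Θ)/(μ−Θ))·max_{j≠i} γ̃_{i,j}(‖x_j‖_{[t−T,t]}) }. For σ > 0 define V_i(t) := sup_{−T≤τ≤0} |x_i(t+τ)|·e^{στ}. Then for every σ > 0, every t ≥ 0 and every i: V_i(t) ≤ max{ e^{−σt}·V_i(0), μ·e^{σT}·sup_{0≤s≤t} V_i(s), max_{j≠i} (μ(1−Θ)/(μ−Θ))·γ̃_{i,j}(e^{σT}·sup_{0≤s≤t} V_j(s)) }. -/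

import Mathlib

open scoped BigOperators

/-- Euclidean norm of a vector in ℝ^m. -/
noncomputable def eNorm {m : ℕ} (v : Fin m → ℝ) : ℝ := Real.sqrt (∑ i, (v i) ^ 2)

/-- Sup (over [α, β]) of the Euclidean norm of a vector-valued signal. -/
noncomputable def vNorm {m : ℕ} (x : ℝ → Fin m → ℝ) (α β : ℝ) : ℝ :=
  sSup ((fun τ => eNorm (x τ)) '' Set.Icc α β)

/-- Max over indices `j ≠ i` of a finite family of reals (as a supremum). -/
noncomputable def maxNe {n : ℕ} (i : Fin n) (g : Fin n → ℝ) : ℝ :=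
  sSup {y | ∃ j, j ≠ i ∧ y = g j}

/-- A function `γ : [0,∞) → [0,∞)` of class N: continuous, non-decreasing, `γ(0)=0`. -/
def ClassN (γ : ℝ → ℝ) : Prop :=
  ContinuousOn γ (Set.Ici 0) ∧ MonotoneOn γ (Set.Ici 0) ∧ γ 0 = 0 ∧ ∀ s, 0 ≤ s → 0 ≤ γ s

/-- The exponentially weighted sup-functional
`V(t) = sup_{-T ≤ τ ≤ 0} |x(t+τ)| e^{στ}` of (A.18). -/
noncomputable def Vfun {m : ℕ} (T σ : ℝ) (x : ℝ → Fin m → ℝ) (t : ℝ) : ℝ :=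
  sSup ((fun τ => eNorm (x (t + τ)) * Real.exp (σ * τ)) '' Set.Icc (-T) 0)

theorem eNorm_nonneg {m : ℕ} (v : Fin m → ℝ) : 0 ≤ eNorm v := Real.sqrt_nonneg _

theorem le_maxNe {n : ℕ} {i j : Fin n} (g : Fin n → ℝ) (h : j ≠ i) : g j ≤ maxNe i g :=
  le_csSup (((Set.finite_range g).subset (by rintro y ⟨j, -, rfl⟩; exact ⟨j, rfl⟩)).bddAbove)
    ⟨j, h, rfl⟩

theorem exists_maxNe_eq {n : ℕ} (hn : 2 ≤ n) (i : Fin n) (g : Fin n → ℝ) :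
    ∃ j, j ≠ i ∧ maxNe i g = g j := by
  have : Nontrivial (Fin n) := Fin.nontrivial_iff_two_le.mpr hn
  obtain ⟨j, hj⟩ := exists_ne i
  exact Set.Nonempty.csSup_mem (s := {y | ∃ j, j ≠ i ∧ y = g j}) ⟨g j, j, hj, rfl⟩
    ((Set.finite_range g).subset (by rintro y ⟨j, -, rfl⟩; exact ⟨j, rfl⟩))

theorem vNorm_nonneg {m : ℕ} (x : ℝ → Fin m → ℝ) (α β : ℝ) : 0 ≤ vNorm x α β :=
  Real.sSup_nonneg (by rintro _ ⟨τ, -, rfl⟩; exact eNorm_nonneg _)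

section Weighted

variable {m : ℕ} {x : ℝ → Fin m → ℝ} {T σ M : ℝ}

/-- The weighted values entering `Vfun` are bounded by any bound of the signal. -/
theorem weighted_le (hσ : 0 < σ) (hx : ∀ t, -T ≤ t → eNorm (x t) ≤ M) {t τ : ℝ} (ht : 0 ≤ t)
    (hτ : τ ∈ Set.Icc (-T) 0) : eNorm (x (t + τ)) * Real.exp (σ * τ) ≤ M :=
  (mul_le_of_le_one_right (eNorm_nonneg _)
    (Real.exp_le_one_iff.mpr (mul_nonpos_of_nonneg_of_nonpos hσ.le hτ.2))).trans
    (hx _ (by linarith [hτ.1]))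

theorem weighted_le_Vfun (hσ : 0 < σ) (hx : ∀ t, -T ≤ t → eNorm (x t) ≤ M) {t τ : ℝ} (ht : 0 ≤ t)
    (hτ : τ ∈ Set.Icc (-T) 0) : eNorm (x (t + τ)) * Real.exp (σ * τ) ≤ Vfun T σ x t :=
  le_csSup ⟨M, by rintro _ ⟨r, hr, rfl⟩; exact weighted_le hσ hx ht hr⟩ ⟨τ, hτ, rfl⟩

theorem Vfun_le (hT : 0 < T) (hσ : 0 < σ) (hx : ∀ t, -T ≤ t → eNorm (x t) ≤ M) {t : ℝ}
    (ht : 0 ≤ t) : Vfun T σ x t ≤ M :=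
  csSup_le ((Set.nonempty_Icc.mpr (by linarith)).image _)
    (by rintro _ ⟨r, hr, rfl⟩; exact weighted_le hσ hx ht hr)

theorem vNorm_le_exp_mul_Vfun (hT : 0 < T) (hσ : 0 < σ) (hx : ∀ t, -T ≤ t → eNorm (x t) ≤ M)
    {t : ℝ} (ht : 0 ≤ t) : vNorm x (t - T) t ≤ Real.exp (σ * T) * Vfun T σ x t := by
  refine csSup_le ((Set.nonempty_Icc.mpr (by linarith)).image _) ?_
  rintro _ ⟨r, hr, rfl⟩
  have hV := weighted_le_Vfun hσ hx ht (τ := r - t) ⟨by linarith [hr.1], by linarith [hr.2]⟩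
  rw [add_sub_cancel] at hV
  calc eNorm (x r) ≤ eNorm (x r) * Real.exp (σ * (r - t) + σ * T) :=
        le_mul_of_one_le_right (eNorm_nonneg _)
          (Real.one_le_exp (by rw [← mul_add]; exact mul_nonneg hσ.le (by linarith [hr.1])))
    _ = Real.exp (σ * T) * (eNorm (x r) * Real.exp (σ * (r - t))) := by
        rw [Real.exp_add]; ring
    _ ≤ _ := mul_le_mul_of_nonneg_left hV (Real.exp_pos _).le

theorem vNorm_le_exp_mul_sSup_Vfun (hT : 0 < T) (hσ : 0 < σ)
    (hx : ∀ t, -T ≤ t → eNorm (x t) ≤ M) {s t : ℝ} (hs : s ∈ Set.Icc 0 t) :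
    vNorm x (s - T) s ≤ Real.exp (σ * T) * sSup (Vfun T σ x '' Set.Icc 0 t) := by
  refine (vNorm_le_exp_mul_Vfun hT hσ hx hs.1).trans
    (mul_le_mul_of_nonneg_left (le_csSup ⟨M, ?_⟩ ⟨s, hs, rfl⟩) (Real.exp_pos _).le)
  rintro _ ⟨r, hr, rfl⟩
  exact Vfun_le hT hσ hx hr.1

end Weighted

/-- Estimate (A.21): from the pointwise max-form small-gain bound one obtains, for the
exponentially weighted functionals `V_i`, the fading-memory estimate. -/
theorem weighted_functional_estimate (n : ℕ) (hn : 2 ≤ n) (T : ℝ) (hT : 0 < T)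
    (Θ μ : ℝ) (hΘ0 : 0 ≤ Θ) (hΘμ : Θ < μ) (hμ1 : μ ≤ 1)
    (k : Fin n → ℕ)
    (γt : Fin n → Fin n → ℝ → ℝ) (hγ : ∀ i j, i ≠ j → ClassN (γt i j))
    (x : (i : Fin n) → ℝ → Fin (k i) → ℝ)
    (hbdd : ∃ M : ℝ, ∀ i, ∀ t, -T ≤ t → eNorm (x i t) ≤ M)
    (hx : ∀ t, 0 ≤ t → ∀ i,
      eNorm (x i t) ≤ max (μ * vNorm (x i) (t - T) t)
        (μ * (1 - Θ) / (μ - Θ) * maxNe i (fun j => γt i j (vNorm (x j) (t - T) t)))) :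
    ∀ σ : ℝ, 0 < σ → ∀ t : ℝ, 0 ≤ t → ∀ i,
      Vfun T σ (x i) t ≤
        max (Real.exp (-σ * t) * Vfun T σ (x i) 0)
          (max (μ * Real.exp (σ * T) * sSup (Vfun T σ (x i) '' Set.Icc 0 t))
            (maxNe i (fun j => μ * (1 - Θ) / (μ - Θ) *
              γt i j (Real.exp (σ * T) * sSup (Vfun T σ (x j) '' Set.Icc 0 t))))) := by
  intro σ hσ t ht i
  obtain ⟨M, hM⟩ := hbdd
  refine csSup_le ((Set.nonempty_Icc.mpr (by linarith)).image _) ?_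
  rintro _ ⟨τ, hτ, rfl⟩
  dsimp only
  rcases le_total (t + τ) 0 with hs | hs
  · refine le_max_of_le_left ?_
    have hV := weighted_le_Vfun hσ (hM i) le_rfl (τ := t + τ) ⟨by linarith [hτ.1], hs⟩
    rw [zero_add] at hV
    calc eNorm (x i (t + τ)) * Real.exp (σ * τ)
        = Real.exp (-σ * t) * (eNorm (x i (t + τ)) * Real.exp (σ * (t + τ))) := by
          rw [mul_left_comm, ← Real.exp_add]; ring_nf
      _ ≤ _ := mul_le_mul_of_nonneg_left hV (Real.exp_pos _).le
  · refine le_max_of_le_right ?_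
    have hst : t + τ ∈ Set.Icc 0 t := ⟨hs, by linarith [hτ.2]⟩
    have hvB := fun j => vNorm_le_exp_mul_sSup_Vfun hT hσ (hM j) hst
    have hc : 0 ≤ μ * (1 - Θ) / (μ - Θ) :=
      div_nonneg (mul_nonneg (by linarith) (by linarith)) (by linarith)
    refine (mul_le_of_le_one_right (eNorm_nonneg _) (Real.exp_le_one_iff.mpr
      (mul_nonpos_of_nonneg_of_nonpos hσ.le hτ.2))).trans ((hx _ hs i).trans (max_le_max ?_ ?_))
    · rw [mul_assoc]
      exact mul_le_mul_of_nonneg_left (hvB i) (by linarith)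
    · obtain ⟨j, hj, hmax⟩ := exists_maxNe_eq hn i
        (fun j => γt i j (vNorm (x j) (t + τ - T) (t + τ)))
      rw [hmax]
      have hv := vNorm_nonneg (x j) (t + τ - T) (t + τ)
      exact (mul_le_mul_of_nonneg_left
        ((hγ i j hj.symm).2.1 hv (hv.trans (hvB j)) (hvB j)) hc).trans
        (le_maxNe (fun j => μ * (1 - Θ) / (μ - Θ) *
          γt i j (Real.exp (σ * T) * sSup (Vfun T σ (x j) '' Set.Icc 0 t))) hj)
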